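/- Let Λ be a p×k real matrix that is pure with factor map f, let C be a k×k real matrix with unit diagonal, let D be a diagonal p×p real matrix, and set S = ΛCΛᵀ + D. Let q ≠ r be two columns (factors) such that f⁻¹(q) and f⁻¹(r) are both nonempty. Then C_{qr} = 0 if and only if S_{ij} = 0 for all i ∈ f⁻¹(q) and all j ∈ f⁻¹(r). -/

import Mathlib

open Matrix

/-- If each row `i` of `Λ` is supported in column `f i`, the entries of `ΛCΛᵀ` are products of
the two loadings with the corresponding entry of `C`. -/
theorem mul_mul_transpose_apply_of_row_support {m n R : Type*} [Fintype n] [CommSemiring R]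
    {f : m → n} {Λ : Matrix m n R} (hΛ : ∀ i j, j ≠ f i → Λ i j = 0) (C : Matrix n n R)
    (i j : m) : (Λ * C * Λᵀ) i j = Λ i (f i) * C (f i) (f j) * Λ j (f j) := by
  rw [Matrix.mul_apply, Fintype.sum_eq_single (f j), Matrix.mul_apply,
    Fintype.sum_eq_single (f i), transpose_apply]
  · intro x hx
    rw [hΛ i x hx, zero_mul]
  · intro x hx
    rw [transpose_apply, hΛ j x hx, mul_zero]

/-- In `S = ΛCΛᵀ + D` with pure `Λ` (factor map `f`), `C` with unit
diagonal, diagonal `D`, and two distinct factors `q ≠ r` each having at least one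
indicator: `C q r = 0` iff `S i j = 0` for all indicators `i` of `q` and `j` of `r`. -/
theorem interfactor_correlation_zero_iff_cross_block_zero
    {p k : ℕ} (f : Fin p → Fin k)
    (Λ : Matrix (Fin p) (Fin k) ℝ)
    (hpure : ∀ (i : Fin p) (j : Fin k), Λ i j ≠ 0 ↔ j = f i)
    (C : Matrix (Fin k) (Fin k) ℝ) (hCdiag : ∀ j, C j j = 1)
    (D : Matrix (Fin p) (Fin p) ℝ) (hD : D.IsDiag)
    (S : Matrix (Fin p) (Fin p) ℝ) (hS : S = Λ * C * Λᵀ + D)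
    (q r : Fin k) (hqr : q ≠ r)
    (hq : ∃ i : Fin p, f i = q) (hr : ∃ j : Fin p, f j = r) :
    C q r = 0 ↔ ∀ i j : Fin p, f i = q → f j = r → S i j = 0 := by
  have hne (i : Fin p) : Λ i (f i) ≠ 0 := (hpure i _).2 rfl
  have hentry (i j : Fin p) (hi : f i = q) (hj : f j = r) :
      S i j = 0 ↔ C q r = 0 := by
    have hij : i ≠ j := by
      rintro rfl
      exact hqr (hi.symm.trans hj)
    rw [hS, Matrix.add_apply, hD hij, add_zero,
      mul_mul_transpose_apply_of_row_support
        (fun i j h => not_not.1 (mt (hpure i j).1 h)), ← hi, ← hj]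
    simp [hne]
  obtain ⟨i, hi⟩ := hq
  obtain ⟨j, hj⟩ := hr
  exact ⟨fun h i j hi hj => (hentry i j hi hj).2 h,
    fun h => (hentry i j hi hj).1 (h i j hi hj)⟩
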